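/- For a connected simple graph G, the group choice number satisfies χ_gl(G) = Δ(G) + 1 if and only if G is either a cycle or a complete graph. -/

import Mathlib

open SimpleGraph

/-- `G` is `A`-colorable for the Abelian group `A`: for every "oriented weight" `f` on the
edges (encoded as an antisymmetric function on ordered pairs, which is equivalent to fixing an
orientation `D` of `E(G)` and a function `E(G) → A`), there is an `(A,f)`-coloring, i.e. a
vertex coloring `c : V → A` with `c u - c v ≠ f u v` for every edge oriented from `u` to `v`. -/
def IsGroupColorable {V : Type*} (G : SimpleGraph V) (A : Type) [AddCommGroup A] : Prop :=
  ∀ f : V → V → A, (∀ u v, f v u = - f u v) →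
    ∃ c : V → A, ∀ u v, G.Adj u v → c u - c v ≠ f u v

/-- The group chromatic number `χ_g(G)`: the least `m` such that `G` is `A`-colorable for
every Abelian group `A` of order at least `m`. -/
noncomputable def groupChromaticNumber {V : Type*} (G : SimpleGraph V) : ℕ :=
  sInf {m : ℕ | ∀ (A : Type) [AddCommGroup A] [Fintype A],
    m ≤ Fintype.card A → IsGroupColorable G A}

/-- `G` is group `k`-choosable: for every Abelian group `A` of order at least `k`, every
`k`-uniform list assignment `L`, and every antisymmetric edge weight `f` (i.e. an orientation
together with a function `E(G) → A`), there is an `(A,L,f)`-coloring. -/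
def IsGroupChoosable {V : Type*} (G : SimpleGraph V) (k : ℕ) : Prop :=
  ∀ (A : Type) [AddCommGroup A] [Fintype A], k ≤ Fintype.card A →
    ∀ L : V → Finset A, (∀ v, (L v).card = k) →
      ∀ f : V → V → A, (∀ u v, f v u = - f u v) →
        ∃ c : V → A, (∀ v, c v ∈ L v) ∧ ∀ u v, G.Adj u v → c u - c v ≠ f u v

/-- The group choice number `χ_gl(G)`: the least `k` such that `G` is group `k`-choosable. -/
noncomputable def groupChoiceNumber {V : Type*} (G : SimpleGraph V) : ℕ :=
  sInf {k : ℕ | IsGroupChoosable G k}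

/-- `G` is group `k`-edge-choosable iff its line graph is group `k`-choosable. -/
def IsGroupEdgeChoosable {V : Type*} (G : SimpleGraph V) (k : ℕ) : Prop :=
  IsGroupChoosable G.lineGraph k

/-- The group edge chromatic number `χ'_g(G) = χ_g(𝓛(G))`. -/
noncomputable def groupEdgeChromaticNumber {V : Type*} (G : SimpleGraph V) : ℕ :=
  groupChromaticNumber G.lineGraph

/-- The group edge choice number `χ'_gl(G) = χ_gl(𝓛(G))`. -/
noncomputable def groupEdgeChoiceNumber {V : Type*} (G : SimpleGraph V) : ℕ :=
  groupChoiceNumber G.lineGraph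

/-- `G` is a cycle (of some length `n ≥ 3`). -/
def IsCycleGraph {V : Type*} (G : SimpleGraph V) : Prop :=
  ∃ n : ℕ, 3 ≤ n ∧ Nonempty (G ≃g cycleGraph n)

section

open scoped Classical in
/-- The number of neighbours of `v` in `S`. -/
noncomputable def degreeIn {V : Type*} (G : SimpleGraph V) (S : Finset V) (v : V) : ℕ :=
  (S.filter (G.Adj v)).card

/-- `G[S]` is (pre)connected, phrased through edge cuts. -/
def CutConnected {V : Type*} (G : SimpleGraph V) (S : Finset V) : Prop :=
  ∀ T ⊆ S, T.Nonempty → T ≠ S → ∃ a ∈ T, ∃ b ∈ S, b ∉ T ∧ G.Adj a b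

/-- `G[S]` has an `(A, L, f)`-coloring. -/
def IsListColorableOn {V A : Type*} [AddCommGroup A] (G : SimpleGraph V) (f : V → V → A)
    (L : V → Finset A) (S : Finset V) : Prop :=
  ∃ c : V → A, (∀ v ∈ S, c v ∈ L v) ∧ ∀ u ∈ S, ∀ v ∈ S, G.Adj u v → c u - c v ≠ f u v

/-- `G[S]` is connected and has no `(A, L, f)`-coloring although each list is at least as large
as the degree of its vertex. -/
structure IsDegreeObstruction {V A : Type*} [AddCommGroup A] (G : SimpleGraph V)
    (f : V → V → A) (L : V → Finset A) (S : Finset V) : Prop where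
  connected : CutConnected G S
  degree_le : ∀ v ∈ S, degreeIn G S v ≤ (L v).card
  not_colorable : ¬ IsListColorableOn G f L S

/-- `C` is a nonempty proper union of components of `G[S \ {w}]`. -/
structure IsVertexCut {V : Type*} (G : SimpleGraph V) (S : Finset V) (w : V) (C : Finset V) :
    Prop where
  mem : w ∈ S
  subset : C ⊆ S
  notMem : w ∉ C
  nonempty : C.Nonempty
  exists_mem_compl : ∃ d ∈ S, d ≠ w ∧ d ∉ C
  not_adj : ∀ a ∈ C, ∀ b ∈ S, b ≠ w → b ∉ C → ¬ G.Adj a b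

/-- A cut whose side `C` contains no further cut vertices. -/
structure IsEndCut {V : Type*} [DecidableEq V] (G : SimpleGraph V) (S : Finset V) (w : V)
    (C : Finset V) : Prop extends IsVertexCut G S w C where
  connected : CutConnected G C
  connected_erase : ∀ v ∈ C, CutConnected G (S.erase v)

variable {V A : Type*} [AddCommGroup A] {G : SimpleGraph V} {S T C : Finset V}
  {u v w : V} {f : V → V → A} {L : V → Finset A}

lemma degreeIn_mono (h : T ⊆ S) (v : V) : degreeIn G T v ≤ degreeIn G S v := by
  classical
  exact Finset.card_le_card (Finset.filter_subset_filter _ h)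

lemma degreeIn_lt (h : T ⊆ S) (hv : v ∈ S) (hvT : v ∉ T) (huv : G.Adj u v) :
    degreeIn G T u < degreeIn G S u := by
  classical
  refine Finset.card_lt_card ⟨Finset.filter_subset_filter _ h, fun hle ↦ hvT ?_⟩
  exact (Finset.mem_filter.1 (hle (Finset.mem_filter.2 ⟨hv, huv⟩))).1

lemma degreeIn_eq_of_not_adj (h : T ⊆ S) (hv : ∀ x ∈ S, x ∉ T → ¬ G.Adj v x) :
    degreeIn G T v = degreeIn G S v := by
  unfold degreeIn
  congr 1
  ext x
  simp only [Finset.mem_filter]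
  grind

lemma degreeIn_eq_card_iff : degreeIn G S v = S.card ↔ ∀ x ∈ S, G.Adj v x := by
  classical
  exact Finset.card_filter_eq_iff

variable [DecidableEq V]

lemma degreeIn_erase_of_adj (hu : u ∈ S) (huv : G.Adj v u) :
    degreeIn G (S.erase u) v + 1 = degreeIn G S v := by
  classical
  have : (S.erase u).filter (G.Adj v) = (S.filter (G.Adj v)).erase u := by
    ext x
    simp [and_assoc]
  unfold degreeIn
  convert Finset.card_erase_add_one (Finset.mem_filter.2 ⟨hu, huv⟩)


lemma degreeIn_erase_of_not_adj (huv : ¬ G.Adj v u) :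
    degreeIn G (S.erase u) v = degreeIn G S v := by
  unfold degreeIn
  congr 1
  ext x
  simp only [Finset.mem_filter, Finset.mem_erase]
  grind

lemma degreeIn_union (h : Disjoint S T) (v : V) :
    degreeIn G (S ∪ T) v = degreeIn G S v + degreeIn G T v := by
  classical
  unfold degreeIn
  rw [← Finset.card_union_of_disjoint (Finset.disjoint_filter_filter h)]
  congr 1
  ext x
  simp only [Finset.mem_filter, Finset.mem_union]
  tauto

lemma degreeIn_insert_self (w : V) : degreeIn G (insert w S) w = degreeIn G S w := by
  classical
  unfold degreeIn
  congr 1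
  ext x
  simp only [Finset.mem_filter, Finset.mem_insert]
  grind [G.irrefl]

lemma IsVertexCut.cutConnected_insert_erase (hC : IsVertexCut G S w C)
    (hv : v ≠ w) (hS : CutConnected G (S.erase v)) :
    CutConnected G ((insert w C).erase v) := by
  obtain ⟨h1, h2, h3, h4, h5, h6⟩ := hC
  have key : ∀ T ⊆ C.erase v, T.Nonempty →
      ∃ a ∈ T, ∃ b ∈ (insert w C).erase v, b ∉ T ∧ G.Adj a b := by
    intro T hT hne
    have hwT : w ∉ T := fun h ↦ h3 (Finset.mem_of_mem_erase (hT h))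
    obtain ⟨a, ha, b, hb, hbT, hab⟩ := hS T (hT.trans (Finset.erase_subset_erase _ h2)) hne
      (fun h ↦ hwT (h ▸ Finset.mem_erase.2 ⟨hv.symm, h1⟩))
    refine ⟨a, ha, b, ?_, hbT, hab⟩
    have := h6 a (Finset.mem_of_mem_erase (hT ha)) b
    grind
  intro T hT hne hne'
  by_cases hw : w ∈ T
  · obtain ⟨a, ha, b, hb, hbT, hab⟩ := key ((insert w C).erase v \ T) (by grind)
      (by rw [Finset.sdiff_nonempty]; exact fun h ↦ hne' (hT.antisymm h))
    exact ⟨b, by grind, a, by grind, by grind, hab.symm⟩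
  · exact key T (by grind) hne

lemma IsVertexCut.cutConnected_insert (hC : IsVertexCut G S w C) (hS : CutConnected G S) :
    CutConnected G (insert w C) := by
  obtain ⟨h1, h2, h3, h4, h5, h6⟩ := hC
  have key : ∀ T ⊆ C, T.Nonempty →
      ∃ a ∈ T, ∃ b ∈ insert w C, b ∉ T ∧ G.Adj a b := by
    intro T hT hne
    obtain ⟨a, ha, b, hb, hbT, hab⟩ := hS T (hT.trans h2) hne (by grind)
    refine ⟨a, ha, b, ?_, hbT, hab⟩
    have := h6 a (hT ha) b
    grind
  intro T hT hne hne'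
  by_cases hw : w ∈ T
  · obtain ⟨a, ha, b, hb, hbT, hab⟩ := key (insert w C \ T) (by grind)
      (by rw [Finset.sdiff_nonempty]; exact fun h ↦ hne' (hT.antisymm h))
    exact ⟨b, by grind, a, by grind, by grind, hab.symm⟩
  · exact key T (by grind) hne

lemma IsVertexCut.compl (hC : IsVertexCut G S w C) : IsVertexCut G S w (S.erase w \ C) := by
  obtain ⟨h1, h2, h3, h4, h5, h6⟩ := hC
  refine ⟨h1, by grind, by grind, ?_, ?_, ?_⟩
  · obtain ⟨d, h⟩ := h5
    exact ⟨d, by grind⟩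
  · obtain ⟨d, h⟩ := h4
    exact ⟨d, by grind⟩
  · intro a ha b hb hbw hbC hab
    exact h6 b (by grind) a (by grind) (by grind) (by grind) hab.symm

lemma IsVertexCut.exists_adj (hC : IsVertexCut G S w C) (hS : CutConnected G S) :
    ∃ a ∈ C, G.Adj w a := by
  obtain ⟨a, ha, b, hb, hbT, hab⟩ := hS C hC.subset hC.nonempty (fun h ↦ hC.notMem (h ▸ hC.mem))
  have := hC.not_adj a ha b hb
  refine ⟨a, ha, ?_⟩
  by_cases h : b = w
  · exact h ▸ hab.symm
  · exact absurd hab (this h hbT)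

lemma exists_isVertexCut_of_not_cutConnected (hw : w ∈ S) (h : ¬ CutConnected G (S.erase w)) :
    ∃ C, IsVertexCut G S w C := by
  unfold CutConnected at h
  push Not at h
  obtain ⟨T, hT, hne, hne', h⟩ := h
  obtain ⟨d, hd, hd'⟩ := Finset.exists_of_ssubset (hT.ssubset_of_ne hne')
  exact ⟨T, hw, by grind, by grind, hne, ⟨d, by grind⟩, fun a ha b hb hbw hbT ↦
    h a ha b (by grind) hbT⟩

lemma exists_isEndCut (hS : CutConnected G S) (hw : w ∈ S) (h : ¬ CutConnected G (S.erase w)) :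
    ∃ w C, IsEndCut G S w C := by
  obtain ⟨C, hC⟩ := exists_isVertexCut_of_not_cutConnected hw h
  obtain ⟨⟨w, C⟩, hC, hmin⟩ := exists_minimalFor_of_wellFoundedLT
    (fun p : V × Finset V ↦ IsVertexCut G S p.1 p.2) (fun p ↦ p.2.card) ⟨(w, C), hC⟩
  have hmin : ∀ v T, IsVertexCut G S v T → ¬ T ⊂ C := fun v T hT hlt ↦
    absurd (hmin (j := (v, T)) hT (Finset.card_le_card hlt.1)) (not_le.2 (Finset.card_lt_card hlt))
  refine ⟨w, C, hC, ?_, ?_⟩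
  · intro T hT hne hne'
    by_contra! h
    refine hmin w T ⟨hC.mem, hT.trans hC.subset, fun h ↦ hC.notMem (hT h), hne, ?_, ?_⟩
      (hT.ssubset_of_ne hne')
    · obtain ⟨d, h⟩ := hC.exists_mem_compl
      exact ⟨d, by grind⟩
    · intro a ha b hb hbw hbT
      by_cases hbC : b ∈ C
      · exact h a ha b hbC hbT
      · exact hC.not_adj a (hT ha) b hb hbw hbC
  · intro v hv
    by_contra h
    have hvw : v ≠ w := fun h ↦ hC.notMem (h ▸ hv)
    obtain ⟨T, hT, hwT⟩ : ∃ T, IsVertexCut G S v T ∧ w ∉ T := by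
      obtain ⟨T, hT⟩ := exists_isVertexCut_of_not_cutConnected (hC.subset hv) h
      by_cases hwT : w ∈ T
      · exact ⟨_, hT.compl, by grind⟩
      · exact ⟨_, hT, hwT⟩
    by_cases hne : (T ∩ C).Nonempty
    · refine hmin v (T ∩ C) ⟨hT.mem, by grind [hT.subset], by grind [hT.notMem], hne,
        ⟨w, hC.mem, hvw.symm, by grind⟩, ?_⟩ ?_
      · intro a ha b hb hbv hbT
        by_cases hb' : b ∈ T
        · exact hC.not_adj a (by grind) b hb (by grind) (by grind)
        · exact hT.not_adj a (by grind) b hb hbv hb'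
      · refine Finset.inter_subset_right.ssubset_of_ne fun h ↦ hT.notMem ?_
        exact (Finset.mem_inter.1 (h.symm ▸ hv)).1
    · rw [Finset.not_nonempty_iff_eq_empty, ← Finset.disjoint_iff_inter_eq_empty,
        Finset.disjoint_left] at hne
      obtain ⟨a, ha, hva⟩ := hT.exists_adj hS
      exact hC.not_adj v hv a (hT.subset ha) (by grind) (hne ha) hva

lemma isListColorableOn_of_forall_exists_degreeIn_lt (hf : ∀ u v, f v u = - f u v)
    (h : ∀ T ⊆ S, T.Nonempty → ∃ v ∈ T, degreeIn G T v < (L v).card) :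
    IsListColorableOn G f L S := by
  classical
  induction S using Finset.strongInduction with
  | H S ih =>
    obtain rfl | hne := S.eq_empty_or_nonempty
    · exact ⟨0, by simp, by simp⟩
    obtain ⟨v, hv, hlt⟩ := h S subset_rfl hne
    obtain ⟨c, hc, hc'⟩ := ih (S.erase v) (Finset.erase_ssubset hv)
      (fun T hT ↦ h T (hT.trans (Finset.erase_subset _ _)))
    obtain ⟨x, hx, hx'⟩ := Finset.exists_mem_notMem_of_card_lt_card
      ((Finset.card_image_le (s := S.filter (G.Adj v)) (f := fun u ↦ c u + f v u)).trans_lt hlt)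
    have hx' : ∀ u ∈ S, G.Adj v u → x - c u ≠ f v u := fun u hu huv heq ↦
      hx' (Finset.mem_image.2 ⟨u, Finset.mem_filter.2 ⟨hu, huv⟩, by rw [← heq]; abel⟩)
    refine ⟨Function.update c v x, fun u hu ↦ ?_, fun u hu w hw huw ↦ ?_⟩
    · obtain rfl | huv := eq_or_ne u v
      · simpa using hx
      · simpa [huv] using hc u (by grind)
    · obtain rfl | huv := eq_or_ne u v
      · simpa [huw.ne'] using hx' w hw huw
      obtain rfl | hwv := eq_or_ne w v
      · have := hx' u hu huw.symm
        rw [hf u w, ne_eq, ← neg_inj, neg_sub, neg_neg] at this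
        simpa [huv] using this
      · simpa [huv, hwv] using hc' u (by grind) w (by grind) huw

lemma CutConnected.isListColorableOn (hS : CutConnected G S) (hf : ∀ u v, f v u = - f u v)
    (hL : ∀ v ∈ S, degreeIn G S v ≤ (L v).card) (hv : v ∈ S) (hlt : degreeIn G S v < (L v).card) :
    IsListColorableOn G f L S := by
  refine isListColorableOn_of_forall_exists_degreeIn_lt hf fun T hT hne ↦ ?_
  by_cases h : T = S
  · exact ⟨v, h ▸ hv, h ▸ hlt⟩
  · obtain ⟨a, ha, b, hb, hbT, hab⟩ := hS T hT hne h
    exact ⟨a, ha, (degreeIn_lt hT hb hbT hab).trans_le (hL a (hT ha))⟩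

lemma IsDegreeObstruction.card_eq (h : IsDegreeObstruction G f L S) (hf : ∀ u v, f v u = - f u v)
    (hv : v ∈ S) : (L v).card = degreeIn G S v := by
  by_contra hne
  exact h.not_colorable (h.connected.isListColorableOn hf h.degree_le hv
    (lt_of_le_of_ne (h.degree_le v hv) (Ne.symm hne)))

open scoped Classical in
/-- The lists that remain after giving `u` the color `a`. -/
noncomputable def listErase (G : SimpleGraph V) (f : V → V → A) (L : V → Finset A) (u : V) (a : A)
    (v : V) : Finset A :=
  if G.Adj u v then (L v).erase (a - f u v) else L v

lemma IsListColorableOn.of_listErase {a : A} (hf : ∀ u v, f v u = - f u v) (ha : a ∈ L u)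
    (h : IsListColorableOn G f (listErase G f L u a) (S.erase u)) : IsListColorableOn G f L S := by
  classical
  obtain ⟨c, hc, hc'⟩ := h
  have hmem : ∀ v ∈ S, v ≠ u → c v ∈ L v := fun v hv hvu ↦ by
    have := hc v (by grind)
    unfold listErase at this
    split_ifs at this
    · exact Finset.mem_of_mem_erase this
    · exact this
  have hadj : ∀ v ∈ S, G.Adj u v → a - c v ≠ f u v := fun v hv huv heq ↦ by
    have := hc v (by grind [huv.ne])
    rw [listErase, if_pos huv] at this
    refine Finset.ne_of_mem_erase this ?_
    rw [← heq]
    abel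
  refine ⟨Function.update c u a, fun v hv ↦ ?_, fun v hv w hw hvw ↦ ?_⟩
  · obtain rfl | hvu := eq_or_ne v u
    · simpa using ha
    · simpa [hvu] using hmem v hv hvu
  · obtain rfl | hvu := eq_or_ne v u
    · simpa [hvw.ne'] using hadj w hw hvw
    obtain rfl | hwu := eq_or_ne w u
    · have := hadj v hv hvw.symm
      rw [hf v w, ne_eq, ← neg_inj, neg_sub, neg_neg] at this
      simpa [hvu] using this
    · simpa [hvu, hwu] using hc' v (by grind) w (by grind) hvw

lemma IsDegreeObstruction.erase {a : A} (h : IsDegreeObstruction G f L S)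
    (hf : ∀ u v, f v u = - f u v) (hu : u ∈ S) (ha : a ∈ L u) (hS : CutConnected G (S.erase u)) :
    IsDegreeObstruction G f (listErase G f L u a) (S.erase u) := by
  classical
  refine ⟨hS, fun v hv ↦ ?_, fun hc ↦ h.not_colorable (hc.of_listErase hf ha)⟩
  have hd := h.degree_le v (Finset.mem_of_mem_erase hv)
  unfold listErase
  split_ifs with huv
  · have := degreeIn_erase_of_adj hu huv.symm
    have := Finset.pred_card_le_card_erase (s := L v) (a := a - f u v)
    lia
  · rwa [degreeIn_erase_of_not_adj fun h ↦ huv h.symm]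

lemma IsDegreeObstruction.degreeIn_le (h : IsDegreeObstruction G f L S)
    (hf : ∀ u v, f v u = - f u v) (hu : u ∈ S) (hv : v ∈ S) (huv : G.Adj u v)
    (hS : CutConnected G (S.erase u)) : degreeIn G S u ≤ degreeIn G S v := by
  classical
  rw [← h.card_eq hf hu, ← h.card_eq hf hv]
  refine Finset.card_le_card_of_injOn (fun a ↦ a - f u v) (fun a ha ↦ ?_)
    (sub_left_injective.injOn)
  by_contra hmem
  have h1 := (h.erase hf hu ha hS).card_eq hf (Finset.mem_erase.2 ⟨huv.ne', hv⟩)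
  rw [listErase, if_pos huv, Finset.erase_eq_of_notMem hmem, h.card_eq hf hv] at h1
  have := degreeIn_erase_of_adj hu huv.symm
  lia

lemma IsDegreeObstruction.degreeIn_eq (h : IsDegreeObstruction G f L S)
    (hf : ∀ u v, f v u = - f u v) (hu : u ∈ S) (hv : v ∈ S) (huv : G.Adj u v)
    (hSu : CutConnected G (S.erase u)) (hSv : CutConnected G (S.erase v)) :
    degreeIn G S u = degreeIn G S v :=
  (h.degreeIn_le hf hu hv huv hSu).antisymm (h.degreeIn_le hf hv hu huv.symm hSv)

/-- The colors `a ∈ L w` such that no coloring of `G[T]` gives `w` the color `a`. -/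
noncomputable def nonextendableColors (G : SimpleGraph V) (f : V → V → A)
    (L : V → Finset A) (w : V) (T : Finset V) : Finset A := by
  classical
  exact (L w).filter fun a ↦ ¬ IsListColorableOn G f (Function.update L w {a}) T

lemma not_isListColorableOn_update_nonextendableColors (hw : w ∈ T) :
    ¬ IsListColorableOn G f (Function.update L w (nonextendableColors G f L w T)) T := by
  classical
  rintro ⟨c, hc, hc'⟩
  have h1 := hc w hw
  rw [Function.update_self, nonextendableColors, Finset.mem_filter] at h1
  refine h1.2 ⟨c, fun v hv ↦ ?_, hc'⟩
  obtain rfl | hvw := eq_or_ne v w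
  · simp
  · simpa [hvw] using hc v hv

/-- An obstruction restricts to either side of a vertex cut, after shrinking the list of the
cut vertex. -/
lemma IsDegreeObstruction.restrict (h : IsDegreeObstruction G f L S)
    (hf : ∀ u v, f v u = - f u v) (hC : IsVertexCut G S w C) :
    ∃ L', IsDegreeObstruction G f L' (insert w C) := by
  classical
  set D := S.erase w \ C
  have hD : IsVertexCut G S w D := hC.compl
  have hCconn := hC.cutConnected_insert h.connected
  have hDconn := hD.cutConnected_insert h.connected
  have hle : ∀ E, IsVertexCut G S w E → ∀ v ∈ insert w E, ∀ X : Finset A,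
      degreeIn G E w ≤ X.card →
      degreeIn G (insert w E) v ≤ (Function.update L w X v).card := by
    intro E hE v hv X hX
    obtain rfl | hvw := eq_or_ne v w
    · simpa [degreeIn_insert_self] using hX
    · have hsub : insert w E ⊆ S := Finset.insert_subset hE.mem hE.subset
      simpa [hvw] using (degreeIn_mono hsub v).trans (h.degree_le v (hsub hv))
  have hbad : (nonextendableColors G f L w (insert w D)).card ≤ degreeIn G D w := by
    by_contra! hlt
    refine not_isListColorableOn_update_nonextendableColors (Finset.mem_insert_self w D)
      (hDconn.isListColorableOn hf (fun v hv ↦ hle D hD v hv _ hlt.le)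
        (Finset.mem_insert_self w D) ?_)
    simpa [degreeIn_insert_self] using hlt
  have hcover : L w ⊆ nonextendableColors G f L w (insert w C) ∪
      nonextendableColors G f L w (insert w D) := by
    intro a ha
    by_contra hmem
    simp only [nonextendableColors, Finset.mem_union, Finset.mem_filter, ha, true_and, not_or,
      not_not] at hmem
    obtain ⟨⟨c, hc, hc'⟩, ⟨d, hd, hd'⟩⟩ := hmem
    have hcw : c w = a := by simpa using hc w (Finset.mem_insert_self w C)
    have hdw : d w = a := by simpa using hd w (Finset.mem_insert_self w D)
    have hED : ∀ v ∈ S, v ∉ C → v ∈ insert w D := by grind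
    have hnot : ∀ u ∈ C, ∀ v ∈ S, v ∉ C → G.Adj u v → v = w := fun u hu v hv hvC huv ↦ by
      by_contra hvw
      exact hC.not_adj u hu v hv hvw hvC huv
    refine h.not_colorable ⟨fun v ↦ if v ∈ C then c v else d v, fun v hv ↦ ?_,
      fun u hu v hv huv ↦ ?_⟩
    · obtain rfl | hvw := eq_or_ne v w
      · simpa [hC.notMem, hdw] using ha
      dsimp only
      split_ifs with hvC
      · simpa [hvw] using hc v (Finset.mem_insert_of_mem hvC)
      · simpa [hvw] using hd v (hED v hv hvC)
    · dsimp only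
      split_ifs with huC hvC hvC
      · exact hc' u (Finset.mem_insert_of_mem huC) v (Finset.mem_insert_of_mem hvC) huv
      · obtain rfl := hnot u huC v hv hvC huv
        rw [hdw, ← hcw]
        exact hc' u (Finset.mem_insert_of_mem huC) v (Finset.mem_insert_self _ _) huv
      · obtain rfl := hnot v hvC u hu huC huv.symm
        rw [hdw, ← hcw]
        exact hc' u (Finset.mem_insert_self _ _) v (Finset.mem_insert_of_mem hvC) huv
      · exact hd' u (hED u hu huC) v (hED v hv hvC) huv
  have hsum : degreeIn G C w + degreeIn G D w = degreeIn G S w := by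
    rw [← degreeIn_union Finset.disjoint_sdiff, ← degreeIn_insert_self (S := C ∪ D)]
    congr 1
    have := hC.subset
    have := hC.mem
    grind
  refine ⟨Function.update L w (nonextendableColors G f L w (insert w C)), hCconn,
    fun v hv ↦ hle C hC v hv _ ?_,
    not_isListColorableOn_update_nonextendableColors (Finset.mem_insert_self w C)⟩
  have h1 := (Finset.card_le_card hcover).trans (Finset.card_union_le _ _)
  have h2 := h.degree_le w hC.mem
  lia

lemma degreeIn_erase_self (S : Finset V) (v : V) : degreeIn G (S.erase v) v = degreeIn G S v :=
  degreeIn_erase_of_not_adj (G.irrefl)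

lemma IsVertexCut.degreeIn_insert (hC : IsVertexCut G S w C) (hv : v ∈ C) :
    degreeIn G (insert w C) v = degreeIn G S v :=
  degreeIn_eq_of_not_adj (Finset.insert_subset hC.mem hC.subset)
    fun x hx hxC ↦ hC.not_adj v hv x hx (by grind) (by grind)

lemma IsVertexCut.degreeIn_insert_lt (hC : IsVertexCut G S w C) (hS : CutConnected G S) :
    degreeIn G (insert w C) w < degreeIn G S w := by
  obtain ⟨x, hx, hwx⟩ := hC.compl.exists_adj hS
  exact degreeIn_lt (Finset.insert_subset hC.mem hC.subset) (hC.compl.subset hx)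
    (by grind) hwx

/-- A regular obstruction has no cut vertex. -/
lemma IsDegreeObstruction.cutConnected_erase {d : ℕ} (h : IsDegreeObstruction G f L S)
    (hf : ∀ u v, f v u = - f u v) (hd : ∀ v ∈ S, degreeIn G S v = d) (hw : w ∈ S) :
    CutConnected G (S.erase w) := by
  by_contra hcon
  obtain ⟨w, C, hC⟩ := exists_isEndCut h.connected hw hcon
  obtain ⟨L', hL'⟩ := h.restrict hf hC.toIsVertexCut
  obtain ⟨v, hv, hwv⟩ := hC.exists_adj h.connected
  have h1 := hL'.degreeIn_le hf (Finset.mem_insert_of_mem hv) (Finset.mem_insert_self w C) hwv.symm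
    (hC.cutConnected_insert_erase hwv.ne' (hC.connected_erase v hv))
  have h2 := hC.degreeIn_insert_lt h.connected
  rw [hC.degreeIn_insert hv, hd v (hC.subset hv)] at h1
  rw [hd w hC.mem] at h2
  lia

lemma IsVertexCut.exists_adj_of_erase [Fintype V]
    (hC : IsVertexCut G (Finset.univ.erase u) w C)
    (hw : CutConnected G (Finset.univ.erase w)) : ∃ a ∈ C, G.Adj u a := by
  obtain ⟨d, hd, hdw, hdC⟩ := hC.exists_mem_compl
  obtain ⟨a, ha, b, hb, hbC, hab⟩ := hw C (by grind [hC.notMem]) hC.nonempty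
    (fun h ↦ hdC (h ▸ by grind))
  refine ⟨a, ha, ?_⟩
  by_contra hua
  exact hC.not_adj a ha b (by grind [G.adj_comm]) (by grind) hbC hab

lemma IsDegreeObstruction.adj_or_exists_clique [Fintype V] {d : ℕ}
    (h : IsDegreeObstruction G f L Finset.univ) (hf : ∀ u v, f v u = - f u v)
    (hd : ∀ v, degreeIn G Finset.univ v = d) (u : V) :
    (∀ v, v ≠ u → G.Adj u v) ∨ ∃ (w : V) (C : Finset V), w ≠ u ∧ ¬ G.Adj u w ∧ C.Nonempty ∧
      C.card + 1 = d ∧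
      ∀ a ∈ C, G.Adj u a ∧ G.Adj w a ∧ ∀ b ∈ C, b ≠ a → G.Adj a b := by
  classical
  by_cases hall : ∀ v, v ≠ u → G.Adj u v
  · exact .inl hall
  refine .inr ?_
  push Not at hall
  obtain ⟨y, hyu, hy⟩ := hall
  obtain ⟨z, hz⟩ : ∃ z, G.Adj u z := by
    obtain ⟨a, ha, b, -, -, hab⟩ := h.connected {u} (Finset.subset_univ _)
      (Finset.singleton_nonempty u) (fun h ↦ hyu (by simpa [← h] using Finset.mem_univ y))
    exact ⟨b, by rwa [Finset.mem_singleton.1 ha] at hab⟩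
  have hpos : 0 < d := by
    have := degreeIn_lt (Finset.empty_subset _) (Finset.mem_univ z) (Finset.notMem_empty z) hz
    rw [hd] at this
    lia
  have h2 : ∀ w, CutConnected G (Finset.univ.erase w) := fun w ↦
    h.cutConnected_erase hf (fun v _ ↦ hd v) (Finset.mem_univ w)
  obtain ⟨a, ha⟩ : (L u).Nonempty := by
    rw [← Finset.card_pos, h.card_eq hf (Finset.mem_univ u), hd]
    exact hpos
  have h' := h.erase hf (Finset.mem_univ u) ha (h2 u)
  have hdeg : ∀ v, G.Adj u v → degreeIn G (Finset.univ.erase u) v + 1 = d := fun v huv ↦ by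
    rw [degreeIn_erase_of_adj (Finset.mem_univ u) huv.symm, hd]
  have hdeg' : ∀ v, ¬ G.Adj u v → degreeIn G (Finset.univ.erase u) v = d := fun v huv ↦ by
    rw [degreeIn_erase_of_not_adj fun h ↦ huv h.symm, hd]
  have hiff : ∀ v ∈ Finset.univ.erase u, ∀ w ∈ Finset.univ.erase u, G.Adj v w →
      CutConnected G ((Finset.univ.erase u).erase v) →
      CutConnected G ((Finset.univ.erase u).erase w) → G.Adj u v → G.Adj u w := by
    intro v hv w hw hvw hcv hcw huv
    by_contra huw
    have := h'.degreeIn_eq hf hv hw hvw hcv hcw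
    have := hdeg v huv
    have := hdeg' w huw
    lia
  have hspread : ∀ T ⊆ Finset.univ.erase u, CutConnected G T →
      (∀ v ∈ T, CutConnected G ((Finset.univ.erase u).erase v)) → (∃ v ∈ T, G.Adj u v) →
      ∀ v ∈ T, G.Adj u v := by
    rintro T hT hTc hTe ⟨v, hv, huv⟩
    by_contra! hne
    obtain ⟨x, hx, hux⟩ := hne
    obtain ⟨a, ha, b, hb, hbT, hab⟩ := hTc (T.filter (G.Adj u)) (Finset.filter_subset _ _)
      ⟨v, by grind⟩ (fun h ↦ hux (Finset.mem_filter.1 (h.symm ▸ hx)).2)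
    rw [Finset.mem_filter] at ha
    exact hbT (Finset.mem_filter.2
      ⟨hb, hiff a (hT ha.1) b (hT hb) hab (hTe a ha.1) (hTe b hb) ha.2⟩)
  obtain ⟨w₀, hw₀, hcut⟩ : ∃ w ∈ Finset.univ.erase u,
      ¬ CutConnected G ((Finset.univ.erase u).erase w) := by
    by_contra! hno
    exact hy (hspread _ subset_rfl (h2 u) hno ⟨z, by simp [hz.ne'], hz⟩ y (by simp [hyu]))
  obtain ⟨w, C, hC⟩ := exists_isEndCut (h2 u) hw₀ hcut
  have huC : ∀ a ∈ C, G.Adj u a := hspread C hC.subset hC.connected hC.connected_erase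
    (hC.exists_adj_of_erase (h2 w))
  obtain ⟨L', hL'⟩ := h'.restrict hf hC.toIsVertexCut
  have hdegC : ∀ v ∈ C, degreeIn G (insert w C) v + 1 = d := fun v hv ↦ by
    rw [hC.degreeIn_insert hv, hdeg v (huC v hv)]
  have hdegw : degreeIn G (insert w C) w + 1 = d := by
    obtain ⟨v, hv, hwv⟩ := hC.exists_adj (h2 u)
    rw [hL'.degreeIn_eq hf (Finset.mem_insert_self w C) (Finset.mem_insert_of_mem hv) hwv
      (by simpa [Finset.erase_insert hC.notMem] using hC.connected)
      (hC.cutConnected_insert_erase hwv.ne' (hC.connected_erase v hv)), hdegC v hv]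
  have huw : ¬ G.Adj u w := fun huw ↦ by
    have := hC.degreeIn_insert_lt (h2 u)
    have := hdeg w huw
    lia
  have hcard : C.card < d := by
    obtain ⟨x, hx, hux⟩ := hC.compl.exists_adj_of_erase (h2 w)
    rw [← degreeIn_eq_card_iff.2 huC, ← hd u]
    exact degreeIn_lt (Finset.subset_univ _) (Finset.mem_univ x) (by grind) hux
  have hle : degreeIn G C w ≤ C.card := Finset.card_filter_le _ _
  rw [degreeIn_insert_self] at hdegw
  have hcard' : C.card + 1 = d := by lia
  have hwC : ∀ a ∈ C, G.Adj w a := degreeIn_eq_card_iff.1 (by lia)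
  refine ⟨w, C, by grind [hC.mem], huw, hC.nonempty, hcard', fun a ha ↦
    ⟨huC a ha, hwC a ha, fun b hb hba ↦ ?_⟩⟩
  refine (degreeIn_eq_card_iff (S := (insert w C).erase a)).1 ?_ b (by grind)
  rw [degreeIn_erase_self, Finset.card_erase_of_mem (by grind), Finset.card_insert_of_notMem
    hC.notMem]
  have := hdegC a ha
  lia

/-- A regular connected graph with an uncolorable degree-sized list assignment is complete or
`2`-regular. -/
lemma IsDegreeObstruction.eq_top_or_eq_two [Fintype V] {d : ℕ}
    (h : IsDegreeObstruction G f L Finset.univ) (hf : ∀ u v, f v u = - f u v)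
    (hd : ∀ v, degreeIn G Finset.univ v = d) : G = ⊤ ∨ d = 2 := by
  by_cases hall : ∃ u, ∀ v, v ≠ u → G.Adj u v
  · left
    obtain ⟨u, hu⟩ := hall
    have hu' := degreeIn_eq_card_iff.2 (fun v (hv : v ∈ Finset.univ.erase u) ↦ hu v (by grind))
    ext v w
    refine ⟨fun h ↦ h.ne, fun hvw ↦ ?_⟩
    refine (degreeIn_eq_card_iff (S := Finset.univ.erase v)).1 ?_ w (by simpa using Ne.symm hvw)
    rw [degreeIn_erase_self, hd, Finset.card_erase_of_mem (Finset.mem_univ _)] at hu' ⊢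
    exact hu'
  right
  have key := fun u ↦ (h.adj_or_exists_clique hf hd u).resolve_left fun hu ↦ hall ⟨u, hu⟩
  obtain ⟨u⟩ : Nonempty V := by
    by_contra hV
    rw [not_nonempty_iff] at hV
    exact h.not_colorable ⟨0, by simp, by simp⟩
  obtain ⟨w, C, hwu, huw, ⟨v, hv⟩, hcard, hC⟩ := key u
  obtain ⟨x, C', hxv, hvx, hne', hcard', hC'⟩ := key v
  by_contra hd2
  have huC : u ∉ C := fun hu ↦ G.irrefl (hC u hu).1
  have hwC : w ∉ C := fun hw ↦ G.irrefl (hC w hw).2.1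
  have hclosed : ∀ z ∈ C, ∀ y, G.Adj z y → y ∈ insert u (insert w C) := by
    intro z hz y hzy
    by_contra hy
    have hlt := degreeIn_lt (T := insert u (insert w (C.erase z))) (Finset.subset_univ _)
      (Finset.mem_univ y) (by grind) hzy
    rw [hd, degreeIn_eq_card_iff.2 (by
      intro a ha
      obtain ⟨h1, h2, h3⟩ := hC z hz
      grind [G.adj_comm]), Finset.card_insert_of_notMem (by grind), Finset.card_insert_of_notMem
      (by grind), Finset.card_erase_of_mem hz] at hlt
    have := Finset.card_pos.2 ⟨z, hz⟩
    lia
  have hdisj : ∀ z ∈ C', z ∉ C := by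
    intro z hz' hz
    have hx := hclosed z hz x (hC' z hz').2.1.symm
    obtain ⟨h1, h2, h3⟩ := hC v hv
    grind [G.adj_comm]
  have hsub : C' ⊆ {u, w} := by
    intro z hz
    have := hclosed v hv z (hC' z hz).1
    grind
  have hpos := Finset.card_pos.2 hne'
  have heq : C' = {u, w} := Finset.eq_of_subset_of_card_le hsub
    (Finset.card_le_two.trans (by lia))
  exact huw ((hC' u (by simp [heq])).2.2 w (by simp [heq]) hwu)

end

lemma cutConnected_univ {V : Type*} [Fintype V] {G : SimpleGraph V} (hG : G.Connected) :
    CutConnected G Finset.univ := by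
  rintro T - ⟨a, ha⟩ hne
  obtain ⟨b, hb⟩ : ∃ b, b ∉ T := by
    by_contra! h
    exact hne (Finset.eq_univ_iff_forall.2 h)
  obtain ⟨p⟩ := hG a b
  obtain ⟨e, -, h1, h2⟩ := p.exists_boundary_dart (T : Set V) ha hb
  exact ⟨e.fst, h1, e.snd, Finset.mem_univ _, h2, e.adj⟩

lemma degreeIn_univ {V : Type*} [Fintype V] (G : SimpleGraph V) [DecidableRel G.Adj] (v : V) :
    degreeIn G Finset.univ v = G.degree v := by
  classical
  rw [← G.card_neighborFinset_eq_degree, degreeIn, G.neighborFinset_eq_filter]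
  congr

lemma isCycleGraph_of_isRegularOfDegree_two {V : Type*} [Fintype V] {G : SimpleGraph V}
    [DecidableRel G.Adj] (hG : G.Connected) (hreg : G.IsRegularOfDegree 2) : IsCycleGraph G := by
  classical
  have hacyc : ¬ G.IsAcyclic := by
    intro h
    obtain ⟨v⟩ := hG.nonempty
    have hv := hreg v
    obtain ⟨w, hw⟩ := (G.degree_pos_iff_exists_adj v).1 (by lia)
    have : Nontrivial V := ⟨v, w, hw.ne⟩
    obtain ⟨x, hx⟩ := IsTree.exists_vert_degree_one_of_nontrivial ⟨hG, h⟩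
    have := hreg x
    lia
  simp only [isAcyclic_iff_free_cycleGraph, Free, not_forall, not_not] at hacyc
  obtain ⟨n, hn, ⟨φ, hφ⟩⟩ := hacyc
  have himage : ∀ i, ((cycleGraph n).neighborFinset i).image φ = G.neighborFinset (φ i) := by
    intro i
    refine Finset.eq_of_subset_of_card_le ?_ ?_
    · intro x hx
      obtain ⟨j, hj, rfl⟩ := Finset.mem_image.1 hx
      simpa using φ.map_adj (by simpa using hj)
    · obtain ⟨m, rfl⟩ := Nat.exists_eq_add_of_le' hn
      rw [Finset.card_image_of_injective _ hφ, card_neighborFinset_eq_degree,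
        card_neighborFinset_eq_degree, hreg, cycleGraph_degree_three_le]
  have hsurj : Function.Surjective φ := by
    by_contra hns
    obtain ⟨a, ha, b, -, hb, hab⟩ := cutConnected_univ hG (Finset.univ.image φ)
      (Finset.subset_univ _) ⟨φ ⟨0, by lia⟩, by simp⟩
      (fun h ↦ hns fun x ↦ by simpa using (Finset.ext_iff.1 h x).2 (Finset.mem_univ x))
    obtain ⟨i, -, rfl⟩ := Finset.mem_image.1 ha
    rw [← mem_neighborFinset, ← himage] at hab
    exact hb (Finset.image_subset_image (Finset.subset_univ _) hab)
  refine ⟨n, hn, ⟨Iso.symm ⟨Equiv.ofBijective φ ⟨hφ, hsurj⟩, fun {i j} ↦ ⟨fun h ↦ ?_, φ.map_adj⟩⟩⟩⟩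
  replace h : G.Adj (φ i) (φ j) := h
  rw [← mem_neighborFinset, ← himage] at h
  obtain ⟨k, hk, hkj⟩ := Finset.mem_image.1 h
  rw [← hφ hkj]
  simpa using hk

lemma IsGroupChoosable.succ {V : Type*} {G : SimpleGraph V} {k : ℕ} (h : IsGroupChoosable G k) :
    IsGroupChoosable G (k + 1) := by
  intro A _ _ hA L hL f hf
  choose L' hL' hcard using fun v ↦ Finset.exists_subset_card_eq (s := L v) (n := k)
    (by rw [hL]; lia)
  obtain ⟨c, hc, hc'⟩ := h A (by lia) L' hcard f hf
  exact ⟨c, fun v ↦ hL' v (hc v), hc'⟩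

lemma isGroupChoosable_maxDegree_add_one {V : Type*} [Fintype V] (G : SimpleGraph V)
    [DecidableRel G.Adj] : IsGroupChoosable G (G.maxDegree + 1) := by
  classical
  intro A _ _ hA L hL f hf
  obtain ⟨c, hc, hc'⟩ : IsListColorableOn G f L Finset.univ :=
    isListColorableOn_of_forall_exists_degreeIn_lt hf fun T hT ⟨v, hv⟩ ↦ ⟨v, hv, by
      have := degreeIn_mono (G := G) hT v
      have := G.degree_le_maxDegree v
      rw [hL]
      rw [degreeIn_univ] at *
      lia⟩
  exact ⟨c, fun v ↦ hc v (Finset.mem_univ v), fun u v ↦ hc' u (Finset.mem_univ u) v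
    (Finset.mem_univ v)⟩

lemma groupChoiceNumber_eq_maxDegree_add_one_iff_not_isGroupChoosable {V : Type*} [Fintype V]
    (G : SimpleGraph V) [DecidableRel G.Adj] :
    groupChoiceNumber G = G.maxDegree + 1 ↔ ¬ IsGroupChoosable G G.maxDegree := by
  have hmem := isGroupChoosable_maxDegree_add_one G
  refine ⟨fun h hc ↦ ?_, fun h ↦ (Nat.sInf_le hmem).antisymm ?_⟩
  · have : groupChoiceNumber G ≤ G.maxDegree := Nat.sInf_le hc
    lia
  · by_contra! hlt
    have h1 : IsGroupChoosable G (groupChoiceNumber G) :=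
      Nat.sInf_mem (s := {k | IsGroupChoosable G k}) ⟨_, hmem⟩
    exact h (Nat.le_induction h1 (fun _ _ ↦ IsGroupChoosable.succ) _ (Nat.lt_succ_iff.1 hlt))

lemma not_isGroupChoosable_two_of_isCycleGraph {V : Type*} {G : SimpleGraph V}
    (hG : IsCycleGraph G) : ¬ IsGroupChoosable G 2 := by
  classical
  obtain ⟨n, hn, ⟨e⟩⟩ := hG
  obtain ⟨m, rfl⟩ := Nat.exists_eq_add_of_le' hn
  intro h
  obtain ⟨c, -, hc⟩ := h (ZMod 2) (by simp) (fun _ ↦ Finset.univ) (by simp)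
    (fun u v ↦ if s(u, v) = s(e.symm 0, e.symm (Fin.last _)) then 0 else 1)
    (fun u v ↦ by simp only [Sym2.eq_swap (a := v)]; exact (ZMod.neg_eq_self_mod_two _).symm)
  have hconst : ∀ i : ℕ, ∀ hi : i < m + 3, c (e.symm ⟨i, hi⟩) = c (e.symm 0) := by
    intro i
    induction i with
    | zero => intro hi; rfl
    | succ i ih =>
      intro hi
      have hadj : (cycleGraph (m + 3)).Adj ⟨i + 1, hi⟩ ⟨i, by lia⟩ := by
        rw [cycleGraph_adj']
        left
        rw [Fin.sub_val_of_le (by simp)]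
        simp
      have h1 := hc _ _ (e.symm.map_rel_iff.2 hadj)
      rw [if_neg (by
        simp only [Sym2.eq_iff, e.symm.injective.eq_iff, Fin.ext_iff]
        simp
        lia)] at h1
      rw [← ih (by lia)]
      generalize c (e.symm ⟨i + 1, hi⟩) = x at h1 ⊢
      generalize c (e.symm ⟨i, _⟩) = y at h1 ⊢
      revert x y
      decide
  have hadj : (cycleGraph (m + 3)).Adj 0 (Fin.last _) := by
    rw [cycleGraph_adj]
    left
    simp
  refine hc _ _ (e.symm.map_rel_iff.2 hadj) ?_
  rw [if_pos rfl, ← hconst (m + 2) (by lia), sub_eq_zero]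
  rfl

lemma not_isGroupChoosable_top {V : Type*} [Fintype V] [Nonempty V] :
    ¬ IsGroupChoosable (⊤ : SimpleGraph V) (Fintype.card V - 1) := by
  intro h
  obtain h0 | hpos := Nat.eq_zero_or_pos (Fintype.card V - 1)
  · rw [h0] at h
    obtain ⟨c, hc, -⟩ := h (ZMod 1) (Nat.zero_le _) (fun _ ↦ ∅) (by simp) 0 (by simp)
    exact absurd (hc (Classical.arbitrary V)) (Finset.notMem_empty _)
  · have : NeZero (Fintype.card V - 1) := ⟨hpos.ne'⟩
    obtain ⟨c, -, hc⟩ := h (ZMod (Fintype.card V - 1)) (ZMod.card _).ge (fun _ ↦ Finset.univ)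
      (by simp [ZMod.card]) 0 (by simp)
    have hinj : Function.Injective c := fun u v huv ↦ by
      by_contra hne
      exact hc u v hne (sub_eq_zero.2 huv)
    have := Fintype.card_le_of_injective c hinj
    rw [ZMod.card] at this
    lia

lemma exists_isDegreeObstruction {V : Type*} [Fintype V] {G : SimpleGraph V} [DecidableRel G.Adj]
    (hG : G.Connected) (h : ¬ IsGroupChoosable G G.maxDegree) :
    ∃ (A : Type) (_ : AddCommGroup A) (f : V → V → A) (L : V → Finset A),
      (∀ u v, f v u = - f u v) ∧ (∀ v, (L v).card = G.maxDegree) ∧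
      IsDegreeObstruction G f L Finset.univ := by
  unfold IsGroupChoosable at h
  push Not at h
  obtain ⟨A, _, _, -, L, hL, f, hf, hno⟩ := h
  refine ⟨A, _, f, L, hf, hL, cutConnected_univ hG, fun v _ ↦ ?_, ?_⟩
  · rw [degreeIn_univ, hL]
    exact G.degree_le_maxDegree v
  · rintro ⟨c, hc, hc'⟩
    obtain ⟨u, v, huv, heq⟩ := hno c fun v ↦ hc v (Finset.mem_univ v)
    exact hc' u (Finset.mem_univ u) v (Finset.mem_univ v) huv heq

/-- For a connected simple graph `G`, `χ_gl(G) = Δ(G) + 1` iff `G` is a cycle or a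
complete graph. -/
theorem groupChoiceNumber_eq_maxDegree_add_one_iff {V : Type*} [Fintype V]
    (G : SimpleGraph V) [DecidableRel G.Adj] (hG : G.Connected) :
    groupChoiceNumber G = G.maxDegree + 1 ↔ IsCycleGraph G ∨ G = ⊤ := by
  classical
  rw [groupChoiceNumber_eq_maxDegree_add_one_iff_not_isGroupChoosable]
  constructor
  · intro h
    obtain ⟨A, _, f, L, hf, hL, hobs⟩ := exists_isDegreeObstruction hG h
    have hd : ∀ v, degreeIn G Finset.univ v = G.maxDegree := fun v ↦ by
      rw [← hobs.card_eq hf (Finset.mem_univ v), hL]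
    obtain htop | htwo := hobs.eq_top_or_eq_two hf hd
    · exact .inr htop
    · exact .inl (isCycleGraph_of_isRegularOfDegree_two hG fun v ↦ by
        rw [← degreeIn_univ, hd, htwo])
  · have := hG.nonempty
    rintro (hcyc | rfl)
    · have hreg : G.IsRegularOfDegree 2 := by
        obtain ⟨n, hn, ⟨e⟩⟩ := hcyc
        obtain ⟨m, rfl⟩ := Nat.exists_eq_add_of_le' hn
        intro v
        rw [← e.degree_eq v, cycleGraph_degree_three_le]
      rw [hreg.maxDegree_eq]
      exact not_isGroupChoosable_two_of_isCycleGraph hcyc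
    · convert not_isGroupChoosable_top (V := V)
      convert maxDegree_top (V := V)
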